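/- If f ∈ H(ℝⁿ;O) with O ⊆ ℝⁿ open and convex, then the Fourier transform ψ(z) = ∫_{ℝⁿ} f(ξ) e^{i⟨z,ξ⟩} dξ, defined for z = x + iy ∈ ℂⁿ with y ∈ −O, belongs to 𝔥(T(−O)): ψ is holomorphic on ℝⁿ + i(−O)°, extends continuously to T(K) = ℝⁿ + iK for every compact convex K ⊂ −O, and for every such K and every N ∈ ℕ one has sup_{z ∈ T(K)} (1+|z|)^N |ψ(z)| < ∞. -/

import Mathlib

open MeasureTheory Complex Filter Topology

noncomputable section

/-- Partial derivative in the `i`-th coordinate direction. -/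
def pd {n : ℕ} (i : Fin n) (f : (Fin n → ℝ) → ℂ) : (Fin n → ℝ) → ℂ :=
  fun x => fderiv ℝ f x (Pi.single i 1)

/-- Multi-index derivative `D^α`. -/
def Dm {n : ℕ} (α : Fin n → ℕ) (f : (Fin n → ℝ) → ℂ) : (Fin n → ℝ) → ℂ :=
  (List.finRange n).foldr (fun i g => (pd i)^[α i] g) f

/-- Order `|α|` of a multi-index. -/
def mOrd {n : ℕ} (α : Fin n → ℕ) : ℕ := ∑ i, α i

/-- Supporting function `h_K(ξ) = sup_{x ∈ K} ⟨ξ,x⟩` of a set `K`. -/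
def hSupp {n : ℕ} (K : Set (Fin n → ℝ)) (ξ : Fin n → ℝ) : ℝ :=
  sSup ((fun x => ∑ i, ξ i * x i) '' K)

/-- The ℓ¹ norm `|ξ|₁ = ∑ i |ξ i|`. -/
def n1 {n : ℕ} (ξ : Fin n → ℝ) : ℝ := ∑ i, |ξ i|

/-- The vector of imaginary parts of `z ∈ ℂⁿ`. -/
def imv {n : ℕ} (z : Fin n → ℂ) : Fin n → ℝ := fun i => (z i).im

/-- Euclidean norm `|z|` on `ℂⁿ`. -/
def cnorm {n : ℕ} (z : Fin n → ℂ) : ℝ := Real.sqrt (∑ i, ‖z i‖ ^ 2)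

/-- Membership in `H(ℝⁿ;O)`. -/
def memH {n : ℕ} (O : Set (Fin n → ℝ)) (f : (Fin n → ℝ) → ℂ) : Prop :=
  ContDiff ℝ (⊤ : ℕ∞) f ∧ ∀ K : Set (Fin n → ℝ), K ⊆ O → IsCompact K → Convex ℝ K →
    ∀ α : Fin n → ℕ, ∃ M : ℝ, ∀ ξ, Real.exp (hSupp K ξ) * ‖Dm α f ξ‖ ≤ M

/-- Fourier transform `ℱ[f](z) = ∫ f(ξ) e^{i⟨z,ξ⟩} dξ` for complex `z`. -/
def FT {n : ℕ} (f : (Fin n → ℝ) → ℂ) (z : Fin n → ℂ) : ℂ :=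
  ∫ ξ : Fin n → ℝ, f ξ * Complex.exp (Complex.I * ∑ i, z i * (ξ i : ℂ))

lemma mul_exp_neg_le {δ : ℝ} (hδ : 0 < δ) (t : ℝ) :
    t * Real.exp (-δ * t) ≤ (2 / δ) * Real.exp (-(δ / 2) * t) := by
  have h1 : δ / 2 * t ≤ Real.exp (δ / 2 * t) := by
    linarith [Real.add_one_le_exp (δ / 2 * t)]
  have h2 : Real.exp (-(δ / 2) * t) = Real.exp (δ / 2 * t) * Real.exp (-δ * t) := by
    rw [← Real.exp_add]; ring_nf
  have h3 : t ≤ 2 / δ * Real.exp (δ / 2 * t) := by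
    calc t = 2 / δ * (δ / 2 * t) := by field_simp
      _ ≤ _ := by gcongr
  rw [h2, ← mul_assoc]
  gcongr

lemma integrable_exp_neg_mul_n1 {n : ℕ} {δ : ℝ} (hδ : 0 < δ) :
    Integrable (fun ξ : Fin n → ℝ => Real.exp (-δ * n1 ξ)) := by
  have h1 : Integrable (fun x : ℝ => Real.exp (-δ * |x|)) := by
    rw [← integrableOn_univ, ← Set.Iic_union_Ioi (a := (0 : ℝ)), integrableOn_union]
    constructor
    · refine (integrableOn_exp_mul_Iic hδ 0).congr_fun (fun x hx => ?_) measurableSet_Iic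
      simp only [Set.mem_Iic] at hx
      simp [abs_of_nonpos hx]
    · refine (integrableOn_exp_mul_Ioi (neg_lt_zero.mpr hδ) 0).congr_fun (fun x hx => ?_)
        measurableSet_Ioi
      simp only [Set.mem_Ioi] at hx
      simp [abs_of_pos hx]
  have h2 := Integrable.fintype_prod (ι := Fin n) (f := fun _ (x : ℝ) => Real.exp (-δ * |x|))
    (μ := fun _ => volume) (fun _ => h1)
  refine h2.congr (Eventually.of_forall fun ξ => ?_)
  simp only [n1, Finset.mul_sum, Real.exp_sum]

/-- Thickening a compact convex set inside `O` turns the weight `e^{h_K}` into exponential decay. -/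
lemma memH.exists_exp_decay {n : ℕ} {O : Set (Fin n → ℝ)} (hO : IsOpen O)
    {f : (Fin n → ℝ) → ℂ} (hf : memH O f) {C : Set (Fin n → ℝ)} (hCO : C ⊆ O)
    (hC : IsCompact C) (hCc : Convex ℝ C) :
    ∃ δ > 0, ∀ α : Fin n → ℕ, ∃ M : ℝ, 0 ≤ M ∧ ∀ x ∈ C, ∀ ξ,
      Real.exp (∑ i, ξ i * x i) * ‖Dm α f ξ‖ ≤ M * Real.exp (-δ * n1 ξ) := by
  obtain ⟨δ, hδ, hsub⟩ := hC.exists_cthickening_subset_open hO hCO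
  refine ⟨δ, hδ, fun α => ?_⟩
  obtain ⟨M, hM⟩ := hf.2 _ hsub hC.cthickening (hCc.cthickening δ) α
  refine ⟨M, le_trans (by positivity) (hM 0), fun x hx ξ => ?_⟩
  have key : ∑ i, ξ i * x i + δ * n1 ξ ≤ hSupp (Metric.cthickening δ C) ξ := by
    have hbdd : BddAbove ((fun x => ∑ i, ξ i * x i) '' Metric.cthickening δ C) :=
      (hC.cthickening.image (by fun_prop)).bddAbove
    refine le_csSup hbdd ⟨fun i => x i + δ * SignType.sign (ξ i), ?_, ?_⟩
    · refine Metric.mem_cthickening_of_dist_le _ x δ C hx ?_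
      refine (dist_pi_le_iff hδ.le).2 fun i => ?_
      rcases lt_trichotomy (ξ i) 0 with h | h | h <;> simp [h, abs_of_pos hδ, hδ.le]
    · simp only [n1, Finset.mul_sum, ← Finset.sum_add_distrib]
      refine Finset.sum_congr rfl fun i _ => ?_
      rw [← self_mul_sign (ξ i)]
      ring
  calc Real.exp (∑ i, ξ i * x i) * ‖Dm α f ξ‖
      = Real.exp (∑ i, ξ i * x i + δ * n1 ξ) * ‖Dm α f ξ‖ * Real.exp (-δ * n1 ξ) := by
        rw [mul_right_comm, ← Real.exp_add]; ring_nf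
    _ ≤ Real.exp (hSupp (Metric.cthickening δ C) ξ) * ‖Dm α f ξ‖ * Real.exp (-δ * n1 ξ) := by
        gcongr
    _ ≤ _ := by
        gcongr
        exact hM ξ

lemma norm_mul_exp_pairing {n : ℕ} (w : ℂ) (z : Fin n → ℂ) (ξ : Fin n → ℝ) :
    ‖w * Complex.exp (Complex.I * ∑ i, z i * (ξ i : ℂ))‖
      = Real.exp (∑ i, ξ i * (-imv z) i) * ‖w‖ := by
  rw [norm_mul, Complex.norm_exp, mul_comm]
  congr 2
  simp [imv, Complex.mul_re, mul_comm, Finset.sum_neg_distrib]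

lemma integrable_mul_exp_pairing {n : ℕ} {g : (Fin n → ℝ) → ℂ} (hg : Continuous g)
    {z : Fin n → ℂ} {δ M : ℝ} (hδ : 0 < δ)
    (h : ∀ ξ, Real.exp (∑ i, ξ i * (-imv z) i) * ‖g ξ‖ ≤ M * Real.exp (-δ * n1 ξ)) :
    Integrable (fun ξ : Fin n → ℝ => g ξ * Complex.exp (Complex.I * ∑ i, z i * (ξ i : ℂ))) := by
  refine ((integrable_exp_neg_mul_n1 hδ).const_mul M).mono'
    (by fun_prop) (Eventually.of_forall fun ξ => ?_)
  rw [norm_mul_exp_pairing]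
  exact h ξ

lemma norm_FT_le {n : ℕ} {g : (Fin n → ℝ) → ℂ}
    {z : Fin n → ℂ} {δ M : ℝ} (hδ : 0 < δ)
    (h : ∀ ξ, Real.exp (∑ i, ξ i * (-imv z) i) * ‖g ξ‖ ≤ M * Real.exp (-δ * n1 ξ)) :
    ‖FT g z‖ ≤ M * ∫ ξ : Fin n → ℝ, Real.exp (-δ * n1 ξ) := by
  rw [← integral_const_mul]
  refine norm_integral_le_of_norm_le ((integrable_exp_neg_mul_n1 hδ).const_mul M)
    (Eventually.of_forall fun ξ => ?_)
  rw [norm_mul_exp_pairing]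
  exact h ξ

lemma Dm_zero {n : ℕ} (f : (Fin n → ℝ) → ℂ) : Dm 0 f = f := by
  have h : ∀ l : List (Fin n),
      l.foldr (fun i g => (pd i)^[(0 : Fin n → ℕ) i] g) f = f := fun l => by
    induction l with
    | nil => rfl
    | cons a l _ => simp
  exact h _

lemma Dm_single {n : ℕ} (i : Fin n) (k : ℕ) (f : (Fin n → ℝ) → ℂ) :
    Dm (Pi.single i k) f = (pd i)^[k] f := by
  have h : ∀ l : List (Fin n), l.Nodup →
      l.foldr (fun j g => (pd j)^[(Pi.single i k : Fin n → ℕ) j] g) f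
        = if i ∈ l then (pd i)^[k] f else f := fun l => by
    induction l with
    | nil => simp
    | cons a l ih =>
      intro hl
      rw [List.nodup_cons] at hl
      rw [List.foldr_cons, ih hl.2]
      by_cases ha : a = i
      · subst ha
        simp [hl.1]
      · simp [Ne.symm ha, ha]
  rw [Dm, h _ (List.nodup_finRange n), if_pos (List.mem_finRange i)]

lemma contDiff_pd {n : ℕ} (i : Fin n) {g : (Fin n → ℝ) → ℂ}
    (hg : ContDiff ℝ (⊤ : ℕ∞) g) : ContDiff ℝ (⊤ : ℕ∞) (pd i g) :=
  (hg.fderiv_right (m := ((⊤ : ℕ∞) : WithTop ℕ∞)) (by simp)).clm_apply contDiff_const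

lemma contDiff_iterate_pd {n : ℕ} (i : Fin n) {g : (Fin n → ℝ) → ℂ}
    (hg : ContDiff ℝ (⊤ : ℕ∞) g) (k : ℕ) : ContDiff ℝ (⊤ : ℕ∞) ((pd i)^[k] g) := by
  induction k with
  | zero => exact hg
  | succ k ih =>
    rw [Function.iterate_succ_apply']
    exact contDiff_pd i ih

lemma FT_pd {n : ℕ} (i : Fin n) {g : (Fin n → ℝ) → ℂ} (hg : Differentiable ℝ g) (z : Fin n → ℂ)
    (h0 : Integrable fun ξ : Fin n → ℝ =>
      g ξ * Complex.exp (Complex.I * ∑ i, z i * (ξ i : ℂ)))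
    (h1 : Integrable fun ξ : Fin n → ℝ =>
      pd i g ξ * Complex.exp (Complex.I * ∑ i, z i * (ξ i : ℂ))) :
    FT (pd i g) z = -(Complex.I * z i) * FT g z := by
  set E : (Fin n → ℝ) → ℂ := fun ξ => Complex.exp (Complex.I * ∑ i, z i * (ξ i : ℂ)) with hE
  have hEder : ∀ ξ, HasFDerivAt E (E ξ • (Complex.I • ∑ j, z j •
      Complex.ofRealCLM.comp (ContinuousLinearMap.proj (R := ℝ) (φ := fun _ : Fin n => ℝ) j))) ξ :=
    fun ξ => by
      have hj : ∀ j : Fin n, HasFDerivAt (fun ξ : Fin n → ℝ => (ξ j : ℂ))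
          (Complex.ofRealCLM.comp
            (ContinuousLinearMap.proj (R := ℝ) (φ := fun _ : Fin n => ℝ) j)) ξ := fun j =>
        (Complex.ofRealCLM.comp
          (ContinuousLinearMap.proj (R := ℝ) (φ := fun _ : Fin n => ℝ) j)).hasFDerivAt
      exact ((HasFDerivAt.fun_sum fun j _ => (hj j).const_mul (z j)).const_mul Complex.I).cexp
  have hEd : Differentiable ℝ E := fun ξ => (hEder ξ).differentiableAt
  have hE' : ∀ ξ, fderiv ℝ E ξ (Pi.single i 1) = (Complex.I * z i) * E ξ := fun ξ => by
    rw [(hEder ξ).fderiv]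
    simp [Pi.single_apply, apply_ite Complex.ofReal, mul_comm]
  have h2 : Integrable fun ξ => g ξ * fderiv ℝ E ξ (Pi.single i 1) := by
    simp_rw [hE']
    refine (h0.const_mul (Complex.I * z i)).congr (Eventually.of_forall fun ξ => ?_)
    simp only [hE]; ring
  have key := integral_mul_fderiv_eq_neg_fderiv_mul_of_integrable (𝕜 := ℂ)
    (μ := (volume : Measure (Fin n → ℝ))) (f := g) (g := E) (v := Pi.single i 1) h1 h2 h0
    (fun ξ _ => hg ξ) (fun ξ _ => hEd ξ)
  have h3 : ∫ ξ, g ξ * fderiv ℝ E ξ (Pi.single i 1) = (Complex.I * z i) * FT g z := by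
    rw [FT, ← integral_const_mul]
    refine integral_congr_ae (Eventually.of_forall fun ξ => ?_)
    simp only [hE']
    simp only [hE]; ring
  rw [h3] at key
  rw [neg_mul, key, neg_neg]
  rfl

lemma hasFDerivAt_mul_exp_pairing {n : ℕ} (w : ℂ) (ξ : Fin n → ℝ) (z : Fin n → ℂ) :
    HasFDerivAt (fun z : Fin n → ℂ => w * Complex.exp (Complex.I * ∑ i, z i * (ξ i : ℂ)))
      ((w * Complex.exp (Complex.I * ∑ i, z i * (ξ i : ℂ))) • (Complex.I • ∑ i, (ξ i : ℂ) •
        ContinuousLinearMap.proj (R := ℂ) (φ := fun _ : Fin n => ℂ) i)) z := by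
  have h := (((HasFDerivAt.fun_sum (u := Finset.univ) fun j _ =>
      (ContinuousLinearMap.proj (R := ℂ) (φ := fun _ : Fin n => ℂ) j).hasFDerivAt (x := z)
        |>.mul_const (ξ j : ℂ)).const_mul Complex.I)).cexp.const_mul w
  rw [mul_smul]
  exact h

lemma norm_sum_smul_proj_le {n : ℕ} (ξ : Fin n → ℝ) :
    ‖Complex.I • ∑ i, (ξ i : ℂ) •
      ContinuousLinearMap.proj (R := ℂ) (φ := fun _ : Fin n => ℂ) i‖ ≤ n1 ξ := by
  rw [norm_smul, Complex.norm_I, one_mul]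
  refine (norm_sum_le _ _).trans (Finset.sum_le_sum fun i _ => ?_)
  rw [norm_smul, Complex.norm_real, Real.norm_eq_abs]
  refine mul_le_of_le_one_right (abs_nonneg _) ?_
  exact ContinuousLinearMap.opNorm_le_bound _ zero_le_one fun z => by
    simpa using norm_le_pi_norm z i

lemma differentiableAt_FT {n : ℕ} {g : (Fin n → ℝ) → ℂ} (hg : Continuous g) {z₀ : Fin n → ℂ}
    {s : Set (Fin n → ℂ)} (hs : s ∈ 𝓝 z₀) {δ M : ℝ} (hδ : 0 < δ) (hM : 0 ≤ M)
    (h : ∀ z ∈ s, ∀ ξ,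
      Real.exp (∑ i, ξ i * (-imv z) i) * ‖g ξ‖ ≤ M * Real.exp (-δ * n1 ξ)) :
    DifferentiableAt ℂ (FT g) z₀ := by
  refine (hasFDerivAt_integral_of_dominated_of_fderiv_le (𝕜 := ℂ)
    (μ := (volume : Measure (Fin n → ℝ)))
    (bound := fun ξ => M * (2 / δ * Real.exp (-(δ / 2) * n1 ξ)))
    hs (Eventually.of_forall fun z => by fun_prop)
    (integrable_mul_exp_pairing hg hδ (h z₀ (mem_of_mem_nhds hs))) (by fun_prop)
    (Eventually.of_forall fun ξ z hz => ?_)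
    (((integrable_exp_neg_mul_n1 (half_pos hδ)).const_mul _).const_mul _)
    (Eventually.of_forall fun ξ z _ => hasFDerivAt_mul_exp_pairing (g ξ) ξ z)).differentiableAt
  rw [norm_smul, norm_mul_exp_pairing]
  calc _ ≤ (M * Real.exp (-δ * n1 ξ)) * n1 ξ := by
        exact mul_le_mul (h z hz ξ) (norm_sum_smul_proj_le ξ) (norm_nonneg _) (by positivity)
    _ = M * (n1 ξ * Real.exp (-δ * n1 ξ)) := by ring
    _ ≤ _ := mul_le_mul_of_nonneg_left (mul_exp_neg_le hδ _) hM

lemma continuous_imv {n : ℕ} : Continuous (imv (n := n)) := by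
  unfold imv
  fun_prop

lemma cnorm_le_sum_norm {n : ℕ} (z : Fin n → ℂ) : cnorm z ≤ ∑ i, ‖z i‖ := by
  refine Real.sqrt_le_iff.2 ⟨by positivity, ?_⟩
  exact Finset.sum_sq_le_sq_sum_of_nonneg fun i _ => norm_nonneg _

lemma one_add_cnorm_pow_le {n : ℕ} (z : Fin n → ℂ) (N : ℕ) :
    (1 + cnorm z) ^ N ≤ (1 + n) ^ N * (1 + ∑ i, ‖z i‖ ^ N) := by
  have hc : cnorm z ≤ n * ‖z‖ := (cnorm_le_sum_norm z).trans <| by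
    simpa using Finset.sum_le_card_nsmul Finset.univ _ _ fun i _ => norm_le_pi_norm z i
  have hc0 : 0 ≤ cnorm z := Real.sqrt_nonneg _
  have hs : 0 ≤ ∑ i, ‖z i‖ ^ N := by positivity
  rcases le_total ‖z‖ 1 with h1 | h1
  · calc (1 + cnorm z) ^ N ≤ (1 + n) ^ N := by
          gcongr
          exact hc.trans (mul_le_of_le_one_right (by positivity) h1)
      _ ≤ _ := le_mul_of_one_le_right (by positivity) (by linarith)
  · obtain ⟨i, hi⟩ : ∃ i, ‖z‖ = ‖z i‖ := by
      rcases isEmpty_or_nonempty (Fin n) with hn | hn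
      · rw [Subsingleton.elim z 0, norm_zero] at h1
        linarith
      · obtain ⟨i, -, hi⟩ := Finset.exists_mem_eq_sup Finset.univ Finset.univ_nonempty
          fun i => ‖z i‖₊
        exact ⟨i, by rw [Pi.norm_def, hi]; rfl⟩
    have h2 : ‖z i‖ ^ N ≤ ∑ i, ‖z i‖ ^ N :=
      Finset.single_le_sum (f := fun i => ‖z i‖ ^ N) (fun _ _ => by positivity)
        (Finset.mem_univ i)
    calc (1 + cnorm z) ^ N ≤ ((1 + n) * ‖z‖) ^ N := by
          gcongr
          linarith
      _ = (1 + n) ^ N * ‖z i‖ ^ N := by rw [mul_pow, hi]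
      _ ≤ _ := by
          gcongr
          linarith

lemma FT_iterate_pd {n : ℕ} (i : Fin n) {g : (Fin n → ℝ) → ℂ} (hg : ContDiff ℝ (⊤ : ℕ∞) g)
    (z : Fin n → ℂ)
    (h : ∀ k, Integrable fun ξ : Fin n → ℝ =>
      (pd i)^[k] g ξ * Complex.exp (Complex.I * ∑ i, z i * (ξ i : ℂ))) (k : ℕ) :
    FT ((pd i)^[k] g) z = (-(Complex.I * z i)) ^ k * FT g z := by
  induction k with
  | zero => simp
  | succ k ih =>
    have h1 := h (k + 1)
    rw [Function.iterate_succ_apply'] at h1 ⊢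
    rw [FT_pd i ((contDiff_iterate_pd i hg k).differentiable (by simp)) z (h k) h1, ih]
    ring

/-- On a tube over a compact convex base, `|ψ|` is rapidly decreasing. -/
lemma memH.FT_rapid_decay {n : ℕ} {O : Set (Fin n → ℝ)} (hO : IsOpen O)
    {f : (Fin n → ℝ) → ℂ} (hf : memH O f) {K : Set (Fin n → ℝ)} (hKO : K ⊆ -O)
    (hK : IsCompact K) (hKc : Convex ℝ K) (N : ℕ) :
    ∃ M : ℝ, ∀ z : Fin n → ℂ, imv z ∈ K → (1 + cnorm z) ^ N * ‖FT f z‖ ≤ M := by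
  obtain ⟨δ, hδ, hdecay⟩ := hf.exists_exp_decay hO (C := -K)
    (fun x hx => by simpa using hKO hx) hK.neg hKc.neg
  choose M hM0 hM using hdecay
  set J := ∫ ξ : Fin n → ℝ, Real.exp (-δ * n1 ξ)
  have hint : ∀ z, imv z ∈ K → ∀ i k, Integrable fun ξ : Fin n → ℝ =>
      (pd i)^[k] f ξ * Complex.exp (Complex.I * ∑ i, z i * (ξ i : ℂ)) := fun z hz i k => by
    refine integrable_mul_exp_pairing (contDiff_iterate_pd i hf.1 k).continuous hδ
      (M := M (Pi.single i k)) fun ξ => ?_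
    rw [← Dm_single]
    exact hM _ _ (by simpa using hz) ξ
  have hbound : ∀ z, imv z ∈ K → ∀ α, ‖FT (Dm α f) z‖ ≤ M α * J := fun z hz α =>
    norm_FT_le hδ fun ξ => hM _ _ (by simpa using hz) ξ
  refine ⟨(1 + n) ^ N * (M 0 * J + ∑ i, M (Pi.single i N) * J), fun z hz => ?_⟩
  calc (1 + cnorm z) ^ N * ‖FT f z‖
      ≤ (1 + n) ^ N * (1 + ∑ i, ‖z i‖ ^ N) * ‖FT f z‖ := by
        gcongr
        exact one_add_cnorm_pow_le z N
    _ = (1 + n) ^ N * (‖FT f z‖ + ∑ i, ‖z i‖ ^ N * ‖FT f z‖) := by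
        rw [← Finset.sum_mul]; ring
    _ ≤ _ := by
        refine mul_le_mul_of_nonneg_left (add_le_add ?_ (Finset.sum_le_sum fun i _ => ?_))
          (by positivity)
        · simpa only [Dm_zero] using hbound z hz 0
        · have h := hbound z hz (Pi.single i N)
          rw [Dm_single, FT_iterate_pd i hf.1 z (hint z hz i)] at h
          simpa using h

/-- If `f ∈ H(ℝⁿ;O)` then its Fourier transform `ψ = ℱ[f]` belongs to
`𝔥(T(−O))`: the defining integral converges for `Im z ∈ −O`, `ψ` is holomorphic on the
tube `ℝⁿ + i(−O)`, and on every tube `T(K)` over a compact convex `K ⊂ −O` it is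
continuous and rapidly decreasing. -/
theorem stmt_5 {n : ℕ} (O : Set (Fin n → ℝ)) (hO : IsOpen O) (hOc : Convex ℝ O)
    (f : (Fin n → ℝ) → ℂ) (hf : memH O f) :
    (∀ z : Fin n → ℂ, imv z ∈ -O →
        Integrable (fun ξ : Fin n → ℝ => f ξ * Complex.exp (Complex.I * ∑ i, z i * (ξ i : ℂ)))) ∧
    DifferentiableOn ℂ (FT f) {z | imv z ∈ -O} ∧
    ∀ K : Set (Fin n → ℝ), K ⊆ -O → IsCompact K → Convex ℝ K →
      ContinuousOn (FT f) {z | imv z ∈ K} ∧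
      ∀ N : ℕ, ∃ M : ℝ, ∀ z : Fin n → ℂ, imv z ∈ K →
        (1 + cnorm z) ^ N * ‖FT f z‖ ≤ M := by
  have hdiff : DifferentiableOn ℂ (FT f) {z | imv z ∈ -O} := fun z₀ hz₀ => by
    obtain ⟨r, hr, hball⟩ := Metric.nhds_basis_closedBall.mem_iff.1
      (hO.neg.mem_nhds (show imv z₀ ∈ -O from hz₀))
    obtain ⟨δ, hδ, hdecay⟩ := hf.exists_exp_decay hO (C := -Metric.closedBall (imv z₀) r)
      (fun x hx => by simpa using hball hx) (isCompact_closedBall _ _).neg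
      (convex_closedBall _ _).neg
    obtain ⟨M, hM0, hM⟩ := hdecay 0
    rw [Dm_zero] at hM
    refine (differentiableAt_FT hf.1.continuous
      (continuous_imv.continuousAt.preimage_mem_nhds (Metric.closedBall_mem_nhds _ hr))
      hδ hM0 fun z hz ξ => hM _ ?_ ξ).differentiableWithinAt
    simpa using hz
  refine ⟨fun z hz => ?_, hdiff, fun K hKO hK hKc =>
    ⟨hdiff.continuousOn.mono fun z hz => hKO hz, hf.FT_rapid_decay hO hKO hK hKc⟩⟩
  obtain ⟨δ, hδ, hdecay⟩ := hf.exists_exp_decay hO (C := {-imv z})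
    (by simpa using hz) isCompact_singleton (convex_singleton _)
  obtain ⟨M, -, hM⟩ := hdecay 0
  rw [Dm_zero] at hM
  exact integrable_mul_exp_pairing hf.1.continuous hδ (hM _ rfl)
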